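/- arXiv:2206.02008 — 3 statements merged into one kernel-verified Lean document; each statement's English description precedes it below -/
import Mathlib

section
/- Let ψ : ℝ³ × ℝ → ℂ be continuously differentiable, and suppose that at every point (x,t) with ψ(x,t) = 0 the spatial differential D_xψ(x,t) : ℝ³ → ℂ ≅ ℝ² (the Fréchet derivative of x ↦ ψ(x,t) at x) is surjective. Then there exist an open set U ⊆ ℝ³ × ℝ containing the zero set {(x,t) : ψ(x,t) = 0} and a map v : ℝ³ × ℝ → ℝ³ such that for every (x,t) ∈ U one has ∂ψ/∂t(x,t) + D_xψ(x,t)(v(x,t)) = 0. -/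
open Function

theorem ContinuousLinearMap.isOpen_setOf_surjective
    {E F : Type*} [NormedAddCommGroup E] [NormedSpace ℝ E]
    [NormedAddCommGroup F] [NormedSpace ℝ F] [FiniteDimensional ℝ F] :
    IsOpen {L : E →L[ℝ] F | Surjective L} := by
  have : CompleteSpace F := FiniteDimensional.complete ℝ F
  rw [isOpen_iff_mem_nhds]
  intro L hL
  obtain ⟨g, hg⟩ := L.exists_rightInverse_of_surjective (LinearMap.range_eq_top.2 hL)
  have hcont : Continuous fun M : E →L[ℝ] F => M.comp g := by fun_prop
  have hunit : {M : E →L[ℝ] F | IsUnit (M.comp g)} ∈ nhds L :=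
    (Units.isOpen.preimage hcont).mem_nhds (by
      change IsUnit (L.comp g)
      rw [hg]
      exact isUnit_one)
  filter_upwards [hunit] with M hM y
  obtain ⟨u, hu⟩ := hM
  refine ⟨g ((↑u⁻¹ : F →L[ℝ] F) y), ?_⟩
  have h := DFunLike.congr_fun u.mul_inv y
  rw [hu] at h
  exact h

theorem fderiv_prodMk_left {E F G : Type*} [NormedAddCommGroup E] [NormedSpace ℝ E]
    [NormedAddCommGroup F] [NormedSpace ℝ F] [NormedAddCommGroup G] [NormedSpace ℝ G]
    {f : E × F → G} {p : E × F} (hf : DifferentiableAt ℝ f p) :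
    fderiv ℝ (fun y => f (y, p.2)) p.1 =
      (fderiv ℝ f p).comp (ContinuousLinearMap.inl ℝ E F) :=
  (hf.hasFDerivAt.comp p.1 (hasFDerivAt_prodMk_left p.1 p.2)).fderiv

theorem transport_equation_exists
    (ψ : EuclideanSpace ℝ (Fin 3) × ℝ → ℂ)
    (hψ : ContDiff ℝ 1 ψ)
    (hsurj : ∀ (x : EuclideanSpace ℝ (Fin 3)) (t : ℝ), ψ (x, t) = 0 →
      Surjective (fderiv ℝ (fun y => ψ (y, t)) x)) :
    ∃ U : Set (EuclideanSpace ℝ (Fin 3) × ℝ), IsOpen U ∧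
      {p : EuclideanSpace ℝ (Fin 3) × ℝ | ψ p = 0} ⊆ U ∧
      ∃ v : EuclideanSpace ℝ (Fin 3) × ℝ → EuclideanSpace ℝ (Fin 3),
        ∀ p ∈ U, deriv (fun τ => ψ (p.1, τ)) p.2
          + fderiv ℝ (fun y => ψ (y, p.2)) p.1 (v p) = 0 := by
  have hcont : Continuous fun p : EuclideanSpace ℝ (Fin 3) × ℝ =>
      fderiv ℝ (fun y => ψ (y, p.2)) p.1 := by
    simp_rw [fun p => fderiv_prodMk_left (hψ.differentiable one_ne_zero p)]
    exact (hψ.continuous_fderiv one_ne_zero).clm_comp continuous_const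
  refine ⟨_, ContinuousLinearMap.isOpen_setOf_surjective.preimage hcont,
    fun p hp => hsurj p.1 p.2 hp, ?_⟩
  have hsol : ∀ p : EuclideanSpace ℝ (Fin 3) × ℝ, ∃ w,
      Surjective (fderiv ℝ (fun y => ψ (y, p.2)) p.1) →
        deriv (fun τ => ψ (p.1, τ)) p.2 + fderiv ℝ (fun y => ψ (y, p.2)) p.1 w = 0 := by
    intro p
    by_cases h : Surjective (fderiv ℝ (fun y => ψ (y, p.2)) p.1)
    · obtain ⟨w, hw⟩ := h (-deriv (fun τ => ψ (p.1, τ)) p.2)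
      exact ⟨w, fun _ => by rw [hw, add_neg_cancel]⟩
    · exact ⟨0, fun h' => absurd h' h⟩
  choose v hv using hsol
  exact ⟨v, hv⟩
end

section
/- Let ψ : ℝ³ × ℝ → ℂ be differentiable, v : ℝ³ × ℝ → ℝ³, and let γ : ℝ × ℝ → ℝ³, (s,t) ↦ γ(s,t), be differentiable with ψ(γ(s,t), t) = 0 for all (s,t). Suppose that at every curve point the transport equation holds: ∂ψ/∂t(γ(s,t),t) + D_xψ(γ(s,t),t)(v(γ(s,t),t)) = 0; that D_xψ(γ(s,t),t) : ℝ³ → ℂ is surjective; and that ∂γ/∂s(s,t) ≠ 0. Then there exists a scalar function f(s,t) ∈ ℝ such that ∂γ/∂t(s,t) = v(γ(s,t),t) + f(s,t)·∂γ/∂s(s,t) for all (s,t); that is, the transport velocity v agrees with the curve velocity up to an arbitrary tangential component. -/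
open Function

/-- A nonzero kernel vector of a surjective linear map whose domain has one dimension more than
its codomain spans the kernel. -/
theorem LinearMap.exists_smul_eq_of_mem_ker {K V W : Type*} [Field K]
    [AddCommGroup V] [Module K V] [FiniteDimensional K V] [AddCommGroup W] [Module K W]
    (A : V →ₗ[K] W) (hA : Surjective A) (hdim : Module.finrank K V = Module.finrank K W + 1)
    {u w : V} (hu : A u = 0) (hu0 : u ≠ 0) (hw : A w = 0) : ∃ c : K, c • u = w := by
  have hker : Module.finrank K (LinearMap.ker A) = 1 := by
    have h := A.finrank_range_add_finrank_ker
    rw [LinearMap.range_eq_top.2 hA, finrank_top] at h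
    omega
  obtain ⟨c, hc⟩ := (finrank_eq_one_iff_of_nonzero' (⟨u, hu⟩ : LinearMap.ker A)
    (by simpa [Subtype.ext_iff] using hu0)).1 hker ⟨w, hw⟩
  exact ⟨c, congrArg Subtype.val hc⟩

theorem velocity_condition
    (ψ : EuclideanSpace ℝ (Fin 3) × ℝ → ℂ) (hψ : Differentiable ℝ ψ)
    (v : EuclideanSpace ℝ (Fin 3) × ℝ → EuclideanSpace ℝ (Fin 3))
    (γ : ℝ × ℝ → EuclideanSpace ℝ (Fin 3)) (hγ : Differentiable ℝ γ)
    (hzero : ∀ s t, ψ (γ (s, t), t) = 0)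
    (htransport : ∀ s t, deriv (fun τ => ψ (γ (s, t), τ)) t
      + fderiv ℝ (fun y => ψ (y, t)) (γ (s, t)) (v (γ (s, t), t)) = 0)
    (hsurj : ∀ s t, Surjective (fderiv ℝ (fun y => ψ (y, t)) (γ (s, t))))
    (hreg : ∀ s t, deriv (fun σ => γ (σ, t)) s ≠ 0) :
    ∃ f : ℝ × ℝ → ℝ, ∀ s t,
      deriv (fun τ => γ (s, τ)) t
        = v (γ (s, t), t) + f (s, t) • deriv (fun σ => γ (σ, t)) s := by
  suffices h : ∀ p : ℝ × ℝ, ∃ c : ℝ, c • deriv (fun σ => γ (σ, p.2)) p.1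
      = deriv (fun τ => γ (p.1, τ)) p.2 - v (γ p, p.2) by
    choose f hf using h
    exact ⟨f, fun s t => by rw [hf (s, t)]; abel⟩
  rintro ⟨s, t⟩
  have hL := (hψ (γ (s, t), t)).hasFDerivAt
  set L := fderiv ℝ ψ (γ (s, t), t)
  have hx : fderiv ℝ (fun y => ψ (y, t)) (γ (s, t))
      = L.comp (ContinuousLinearMap.inl ℝ (EuclideanSpace ℝ (Fin 3)) ℝ) :=
    (hL.comp (γ (s, t)) (hasFDerivAt_prodMk_left (γ (s, t)) t)).fderiv
  have ht : deriv (fun τ => ψ (γ (s, t), τ)) t = L (0, 1) :=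
    (hL.comp_hasDerivAt t ((hasDerivAt_const t (γ (s, t))).prodMk (hasDerivAt_id t))).deriv
  have hγs : HasDerivAt (fun σ => γ (σ, t)) (deriv (fun σ => γ (σ, t)) s) s :=
    DifferentiableAt.hasDerivAt (by fun_prop)
  have hγt : HasDerivAt (fun τ => γ (s, τ)) (deriv (fun τ => γ (s, τ)) t) t :=
    DifferentiableAt.hasDerivAt (by fun_prop)
  have hcurve_s : L (deriv (fun σ => γ (σ, t)) s, 0) = 0 := by
    have h := HasFDerivAt.comp_hasDerivAt (f := fun σ => (γ (σ, t), t)) s hL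
      (hγs.prodMk (hasDerivAt_const s t))
    refine h.unique ?_
    simpa [comp_def, hzero] using hasDerivAt_const s (0 : ℂ)
  have hcurve_t : L (deriv (fun τ => γ (s, τ)) t, 1) = 0 := by
    have h := HasFDerivAt.comp_hasDerivAt (f := fun τ => (γ (s, τ), τ)) t hL
      (hγt.prodMk (hasDerivAt_id t))
    refine h.unique ?_
    simpa [comp_def, hzero] using hasDerivAt_const t (0 : ℂ)
  have htr := htransport s t
  rw [ht, hx] at htr
  have hsur := hsurj s t
  rw [hx] at hsur
  refine LinearMap.exists_smul_eq_of_mem_ker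
    (L.comp (ContinuousLinearMap.inl ℝ (EuclideanSpace ℝ (Fin 3)) ℝ)).toLinearMap hsur
    (by simp [Complex.finrank_real_complex]) (by simpa using hcurve_s) (hreg s t) ?_
  have hsub : L (deriv (fun τ => γ (s, τ)) t, 1) - (L (0, 1) + L (v (γ (s, t), t), 0)) = 0 := by
    rw [hcurve_t, sub_eq_zero]
    simpa using htr.symm
  rw [← map_add, ← map_sub] at hsub
  simpa using hsub
end

section
/- Let M ⊆ ℝ³ be open and simply connected, let φ : M → ℂ be continuously differentiable with φ(x) ≠ 0 for all x ∈ M, and let γ : [0,1] → M be continuously differentiable with γ(0) = γ(1). Then ∫₀¹ Im( (fderiv ℝ φ (γ(t)))(γ'(t)) / φ(γ(t)) ) dt = 0; that is, the integral of the differential of the argument of φ along any closed curve in M vanishes. -/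
open Set Filter Topology

/-- A nowhere vanishing continuous function on a simply connected open set has a continuous
logarithm there. -/
theorem exists_continuousOn_exp_eq {E : Type*} [NormedAddCommGroup E] [NormedSpace ℝ E]
    {M : Set E} (hM : IsOpen M) [SimplyConnectedSpace M] {φ : E → ℂ}
    (hφ : ContinuousOn φ M) (hφ0 : ∀ x ∈ M, φ x ≠ 0) :
    ∃ L : E → ℂ, ContinuousOn L M ∧ ∀ x ∈ M, Complex.exp (L x) = φ x := by
  classical
  have : LocallyPathConnectedSpace M := hM.locallyPathConnectedSpace
  obtain ⟨a⟩ : Nonempty M := inferInstance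
  obtain ⟨F, ⟨-, hF⟩, -⟩ := Complex.isCoveringMapOn_exp.existsUnique_continuousMap_lifts
    ⟨M.domRestrict φ, hφ.domRestrict⟩ (a₀ := a) (e₀ := Complex.log (φ a))
    (Complex.exp_log (hφ0 a a.2)) (fun x ↦ hφ0 x x.2)
  refine ⟨fun x ↦ if h : x ∈ M then F ⟨x, h⟩ else 0, ?_, fun x hx ↦ ?_⟩
  · rw [continuousOn_iff_continuous_domRestrict]
    convert F.continuous using 1
    ext x
    simp
  · simpa [hx] using congr_fun hF ⟨x, hx⟩

/-- A continuous logarithm of a differentiable function is differentiable, and its derivative is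
the logarithmic derivative. -/
theorem HasFDerivAt.of_cexp_comp {E : Type*} [NormedAddCommGroup E] [NormedSpace ℝ E]
    {L φ : E → ℂ} {φ' : E →L[ℝ] ℂ} {x : E} (hL : ContinuousAt L x) (hφ : HasFDerivAt φ φ' x)
    (h : ∀ᶠ y in 𝓝 x, Complex.exp (L y) = φ y) : HasFDerivAt L ((φ x)⁻¹ • φ') x := by
  have hexp : HasFDerivAt Complex.exp (Complex.exp (L x) • ContinuousLinearMap.id ℝ ℂ) (L x) := by
    refine ((Complex.hasDerivAt_exp (L x)).hasFDerivAt.restrictScalars ℝ).congr_fderiv ?_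
    ext; simp [mul_comm]
  have := hexp.of_comp_of_leftInverse (f'symm := (φ x)⁻¹ • ContinuousLinearMap.id ℝ ℂ) hL hφ h
    fun z ↦ by simp [← h.self_of_nhds]
  exact this.congr_fderiv (by ext; simp)

theorem integral_d_arg_closed_curve_eq_zero
    (M : Set (EuclideanSpace ℝ (Fin 3))) (hM : IsOpen M)
    (hsc : SimplyConnectedSpace M)
    (φ : EuclideanSpace ℝ (Fin 3) → ℂ)
    (hφ : ContDiffOn ℝ 1 φ M) (hφ0 : ∀ x ∈ M, φ x ≠ 0)
    (γ : ℝ → EuclideanSpace ℝ (Fin 3))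
    (hγ : ContDiffOn ℝ 1 γ (Set.Icc 0 1))
    (hγM : ∀ t ∈ Set.Icc (0:ℝ) 1, γ t ∈ M)
    (hclosed : γ 0 = γ 1) :
    ∫ t in (0:ℝ)..1,
      ((fderiv ℝ φ (γ t)) (derivWithin γ (Set.Icc 0 1) t) / φ (γ t)).im = 0 := by
  obtain ⟨L, hL, hLφ⟩ := exists_continuousOn_exp_eq hM hφ.continuousOn hφ0
  have hL' (x) (hx : x ∈ M) : HasFDerivAt L ((φ x)⁻¹ • fderiv ℝ φ x) x :=
    .of_cexp_comp (hL.continuousAt (hM.mem_nhds hx))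
      ((hφ.differentiableOn one_ne_zero).differentiableAt (hM.mem_nhds hx)).hasFDerivAt
      (eventually_of_mem (hM.mem_nhds hx) hLφ)
  have hcont : ContinuousOn (fun t ↦
      ((fderiv ℝ φ (γ t)) (derivWithin γ (Icc 0 1) t) / φ (γ t)).im) (Icc 0 1) := by
    refine Complex.continuous_im.comp_continuousOn (.div (.clm_apply ?_ ?_) ?_
      fun t ht ↦ hφ0 _ (hγM t ht))
    · exact (hφ.continuousOn_fderiv_of_isOpen hM le_rfl).comp hγ.continuousOn hγM
    · exact hγ.continuousOn_derivWithin (uniqueDiffOn_Icc one_pos) le_rfl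
    · exact hφ.continuousOn.comp hγ.continuousOn hγM
  rw [intervalIntegral.integral_eq_sub_of_hasDerivAt_of_le zero_le_one
    (f := fun t ↦ (L (γ t)).im), hclosed, sub_self]
  · exact Complex.continuous_im.comp_continuousOn (hL.comp hγ.continuousOn hγM)
  · intro t ht
    have hγt : HasDerivAt γ (derivWithin γ (Icc 0 1) t) t :=
      ((hγ.differentiableOn one_ne_zero t (Ioo_subset_Icc_self ht)).hasDerivWithinAt).hasDerivAt
        (Icc_mem_nhds ht.1 ht.2)
    have := Complex.imCLM.hasFDerivAt.comp_hasDerivAt t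
      ((hL' _ (hγM t (Ioo_subset_Icc_self ht))).comp_hasDerivAt t hγt)
    simpa [Function.comp_def, div_eq_inv_mul] using this
  · exact hcont.intervalIntegrable_of_Icc zero_le_one
end
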